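/- arXiv:2304.09678 — 7 statements merged into one kernel-verified Lean document; each statement's English description precedes it below -/
import Mathlib

section
/- Let X be an m×n real matrix with columns x₁,…,xₙ, let δ > 0, and let s ∈ {0,1}ⁿ be a binary vector with T_s = Diag(s). Let N be any Moore–Penrose inverse of the matrix T_s Xᵀ X T_s + δ(I − T_s²), and set Q = X T_s N T_s Xᵀ. Then Q is symmetric, Q² = Q, Q x_j = x_j for every j with s_j = 1, and Q v ∈ span{x_j : s_j = 1} for every v ∈ ℝᵐ; that is, Q is the matrix of the orthogonal projection of ℝᵐ onto span{x_j : s_j = 1}. -/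
open Matrix

/-- Let `N` be a generalized inverse of `A`. If `Yᵀ * Y` factors as `T * A`, then `A` can be cancelled
against `N` to the right of `Y`. -/
theorem Matrix.mul_mul_eq_self_of_transpose_mul_self_eq {m n : Type*} [Fintype m] [Fintype n]
    {Y : Matrix m n ℝ} {T A N : Matrix n n ℝ}
    (hTA : T * A = Yᵀ * Y) (hN : A * N * A = A) : Y * N * A = Y := by
  classical
  have h : Yᴴ * Y * (N * A - 1) = 0 := by
    rw [conjTranspose_eq_transpose_of_trivial, ← hTA, Matrix.mul_sub, Matrix.mul_one,
      Matrix.mul_assoc T, ← Matrix.mul_assoc A, hN, sub_self]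
  rw [conjTranspose_mul_self_mul_eq_zero, Matrix.mul_sub, Matrix.mul_one, sub_eq_zero] at h
  rw [Matrix.mul_assoc, h]

/-- Let `X` be an `m×n` real matrix, `δ > 0`, `s ∈ {0,1}ⁿ`,
`N` a Moore–Penrose inverse of `A = T_s Xᵀ X T_s + δ(I − T_s²)`, and
`Q = X T_s N T_s Xᵀ`.  Then `Q` is symmetric, idempotent, fixes every column
`x_j` with `s_j = 1`, and maps every vector into `span{x_j : s_j = 1}`;
i.e. it is the orthogonal projection onto `span{x_j : s_j = 1}`. -/
theorem stmt_1 {m n : ℕ} (X : Matrix (Fin m) (Fin n) ℝ)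
    (δ : ℝ) (hδ : 0 < δ)
    (s : Fin n → ℝ) (hs : ∀ j, s j = 0 ∨ s j = 1)
    (A N : Matrix (Fin n) (Fin n) ℝ)
    (hA : A = Matrix.diagonal s * (Xᵀ * X) * Matrix.diagonal s
        + δ • (1 - Matrix.diagonal s ^ 2))
    (hN1 : A * N * A = A) (hN2 : N * A * N = N)
    (hN3 : (A * N)ᵀ = A * N) (hN4 : (N * A)ᵀ = N * A)
    (Q : Matrix (Fin m) (Fin m) ℝ)
    (hQ : Q = X * Matrix.diagonal s * N * Matrix.diagonal s * Xᵀ) :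
    Qᵀ = Q ∧ Q * Q = Q ∧
      (∀ j, s j = 1 → Q *ᵥ (fun i => X i j) = fun i => X i j) ∧
      (∀ v : Fin m → ℝ,
        Q *ᵥ v ∈ Submodule.span ℝ {x : Fin m → ℝ | ∃ j, s j = 1 ∧ x = fun i => X i j}) := by
  set T := diagonal s with hT
  have hTt : Tᵀ = T := diagonal_transpose s
  have hTT : T * T = T := by
    rw [hT, diagonal_mul_diagonal]
    congr 1
    funext j
    rcases hs j with h | h <;> simp [h]
  obtain ⟨Y, hY⟩ : ∃ Y, Y = X * T := ⟨_, rfl⟩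
  have hYt : Yᵀ = T * Xᵀ := by rw [hY, transpose_mul, hTt]
  have hYT : Y * T = Y := by rw [hY, Matrix.mul_assoc, hTT]
  have hTYt : T * Yᵀ = Yᵀ := by rw [hYt, ← Matrix.mul_assoc, hTT]
  have hAY : A = Yᵀ * Y + δ • (1 - T) := by
    rw [hA, pow_two, hTT, hYt, hY]
    simp only [Matrix.mul_assoc]
  have hTA : T * A = Yᵀ * Y := by
    rw [hAY, Matrix.mul_add, ← Matrix.mul_assoc, hTYt, Matrix.mul_smul, Matrix.mul_sub,
      Matrix.mul_one, hTT, sub_self, smul_zero, add_zero]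
  have hAT : A * T = Yᵀ * Y := by
    rw [hAY, Matrix.add_mul, Matrix.mul_assoc, hYT, Matrix.smul_mul, Matrix.sub_mul,
      Matrix.one_mul, hTT, sub_self, smul_zero, add_zero]
  have hAt : Aᵀ = A := by
    rw [hAY]
    simp [hTt]
  have hQY : Q = Y * N * Yᵀ := by
    rw [hQ, hYt, hY]
    simp only [Matrix.mul_assoc]
  have hYNA : Y * N * A = Y := mul_mul_eq_self_of_transpose_mul_self_eq hTA hN1
  have hfix : Q * Y = Y := by
    rw [hQY, Matrix.mul_assoc, ← hAT, ← Matrix.mul_assoc, hYNA, hYT]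
  have hANY : A * (Nᵀ * Yᵀ) = Yᵀ := by
    have h := congrArg transpose hYNA
    rwa [transpose_mul, transpose_mul, hAt] at h
  have hcol : ∀ j, s j = 1 → (fun i => X i j) = Y.col j := by
    intro j hj
    funext i
    simp [hY, hT, hj]
  refine ⟨?_, ?_, ?_, ?_⟩
  · calc Qᵀ = Y * (Nᵀ * Yᵀ) := by
          rw [hQY, transpose_mul, transpose_mul, transpose_transpose]
      _ = Y * N * (A * (Nᵀ * Yᵀ)) := by rw [← Matrix.mul_assoc (Y * N), hYNA]
      _ = Q := by rw [hANY, hQY]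
  · calc Q * Q = Q * Y * N * Yᵀ := by
          conv_lhs => rw [hQY]
          rw [hQY]
          simp only [Matrix.mul_assoc]
      _ = Q := by rw [hfix, hQY]
  · intro j hj
    rw [hcol j hj]
    funext i
    exact congrFun (congrFun hfix i) j
  · intro v
    rw [hQY, Matrix.mul_assoc, ← mulVec_mulVec, mulVec_eq_sum]
    refine Submodule.sum_mem _ fun j _ => ?_
    rcases hs j with h | h
    · have h0 : Yᵀ j = 0 := by
        funext i
        simp [hY, hT, h]
      simp [h0]
    · rw [op_smul_eq_smul]
      exact Submodule.smul_mem _ _ (Submodule.subset_span ⟨j, h, (hcol j h).symm⟩)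
end

section
/- Let X be an m×n real matrix and δ > 0. Then there exists a continuous function F from the hypercube [0,1]ⁿ to the m×m real matrices such that F(t) = X T (T Xᵀ X T + δ(I − T²))⁻¹ T Xᵀ for every t ∈ [0,1)ⁿ. In other words, the map t ↦ P̃(t) defined on [0,1)ⁿ extends continuously (entrywise) to all of [0,1]ⁿ. -/
open Matrix

open Filter Topology

/-- The normal equations of a weighted ridge regression are solvable, even when the penalty
vanishes on some coordinates. -/
lemma exists_ridge_solution {m n : ℕ} (A : Matrix (Fin m) (Fin n) ℝ) (d : Fin n → ℝ)
    (hd : ∀ j, 0 ≤ d j) (u : Fin m → ℝ) :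
    ∃ z : Fin n → ℝ, (Aᵀ * A + diagonal d) *ᵥ z = Aᵀ *ᵥ u := by
  set B : Matrix (Fin m ⊕ Fin n) (Fin n) ℝ := fromRows A (diagonal fun j => √(d j)) with hB
  have hBt : Bᵀ = fromCols Aᵀ (diagonal fun j => √(d j)) := by
    rw [hB, transpose_fromRows, diagonal_transpose]
  have hBB : Bᵀ * B = Aᵀ * A + diagonal d := by
    rw [hBt, hB, fromCols_mul_fromRows, diagonal_mul_diagonal]
    simp only [Real.mul_self_sqrt (hd _)]
  have hle : LinearMap.range (Bᵀ * B).mulVecLin ≤ LinearMap.range Bᵀ.mulVecLin := by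
    rw [mulVecLin_mul]
    exact LinearMap.range_comp_le_range _ _
  have hrank : (Bᵀ * B).rank = Bᵀ.rank := by
    rw [rank_transpose_mul_self, rank_transpose]
  have heq := Submodule.eq_of_le_of_finrank_eq hle hrank
  have hmem : Aᵀ *ᵥ u ∈ LinearMap.range Bᵀ.mulVecLin :=
    ⟨Sum.elim u 0, by rw [mulVecLin_apply, hBt, fromCols_mulVec]; simp⟩
  rw [← heq, hBB] at hmem
  exact hmem

/-- The system matrix is of ridge type for the design matrix `X T`. -/
lemma system_matrix_eq {m n : ℕ} (X : Matrix (Fin m) (Fin n) ℝ) (δ : ℝ) (t : Fin n → ℝ) :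
    diagonal t * (Xᵀ * X) * diagonal t + δ • (1 - diagonal t ^ 2) =
      (X * diagonal t)ᵀ * (X * diagonal t) + diagonal fun j => δ * (1 - t j ^ 2) := by
  congr 1
  · simp only [transpose_mul, diagonal_transpose, Matrix.mul_assoc]
  · rw [diagonal_pow, ← diagonal_one, diagonal_sub, ← diagonal_smul]
    rfl

/-- The system matrix is invertible in the half-open cube. -/
lemma isUnit_det_system_matrix {m n : ℕ} (X : Matrix (Fin m) (Fin n) ℝ) {δ : ℝ} (hδ : 0 < δ)
    {t : Fin n → ℝ} (ht : ∀ j, t j ∈ Set.Ico (0 : ℝ) 1) :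
    IsUnit (diagonal t * (Xᵀ * X) * diagonal t + δ • (1 - diagonal t ^ 2)).det := by
  rw [system_matrix_eq, ← isUnit_iff_isUnit_det]
  have hpos : (diagonal fun j => δ * (1 - t j ^ 2)).PosDef :=
    PosDef.diagonal fun j => mul_pos hδ (by nlinarith [(ht j).1, (ht j).2])
  have hsemi : ((X * diagonal t)ᵀ * (X * diagonal t)).PosSemidef := by
    simpa [conjTranspose_eq_transpose_of_trivial] using
      posSemidef_conjTranspose_mul_self (X * diagonal t)
  exact (PosDef.posSemidef_add hsemi hpos).isUnit

/-- A solution of the normal equations, rewritten in terms of the scaled residual. -/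
lemma penalty_mul_eq_of_ridge_solution {m n : ℕ} (X : Matrix (Fin m) (Fin n) ℝ) {δ : ℝ}
    (hδ : 0 < δ) {t z : Fin n → ℝ} {u v : Fin m → ℝ}
    (hz : (diagonal t * (Xᵀ * X) * diagonal t + δ • (1 - diagonal t ^ 2)) *ᵥ z =
      (X * diagonal t)ᵀ *ᵥ u)
    (hv : δ • v = u - X *ᵥ (t * z)) (j : Fin n) :
    (1 - t j ^ 2) * z j = t j * (Xᵀ *ᵥ v) j := by
  have hdiag : ∀ w : Fin n → ℝ, diagonal t *ᵥ w = t * w := fun w => by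
    ext i; simp [mulVec_diagonal]
  rw [system_matrix_eq, add_mulVec, transpose_mul, diagonal_transpose] at hz
  simp only [← mulVec_mulVec, hdiag] at hz
  have h := congrFun hz j
  have hv' := congrArg (fun w => (Xᵀ *ᵥ w) j) hv
  simp only [mulVec_smul, mulVec_sub, Pi.sub_apply, Pi.smul_apply, smul_eq_mul] at hv'
  simp only [Pi.add_apply, Pi.mul_apply, mulVec_diagonal] at h
  apply mul_left_cancel₀ hδ.ne'
  linear_combination h - t j * hv'

/-- Stability estimate for the scaled residual of the normal equations. -/
lemma residual_stability {m n : ℕ} (X : Matrix (Fin m) (Fin n) ℝ) {δ : ℝ} (hδ : 0 < δ)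
    {t t₀ z z₀ : Fin n → ℝ} {u v v₀ : Fin m → ℝ} (ht : ∀ j, 0 < 1 - t j ^ 2)
    (hv : δ • v = u - X *ᵥ (t * z)) (hv₀ : δ • v₀ = u - X *ᵥ (t₀ * z₀))
    (hz : ∀ j, (1 - t j ^ 2) * z j = t j * (Xᵀ *ᵥ v) j)
    (hz₀ : ∀ j, (1 - t₀ j ^ 2) * z₀ j = t₀ j * (Xᵀ *ᵥ v₀) j) :
    δ ^ 2 * ((v - v₀) ⬝ᵥ (v - v₀)) ≤
      δ * ∑ j, ((t j - t₀ j) * ((Xᵀ *ᵥ v₀) j + (t j + t₀ j) * z₀ j)) ^ 2 / (1 - t j ^ 2) +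
        (X *ᵥ ((t - t₀) * z₀)) ⬝ᵥ (X *ᵥ ((t - t₀) * z₀)) := by
  set e := v - v₀ with he
  set d := z - z₀ with hd
  set p := X *ᵥ ((t - t₀) * z₀) with hp
  set r : Fin n → ℝ := fun j => (t j - t₀ j) * ((Xᵀ *ᵥ v₀) j + (t j + t₀ j) * z₀ j) with hr
  have hE : δ • e = -(X *ᵥ (t * d)) - p := by
    rw [he, smul_sub, hv, hv₀, hp, ← neg_add', ← mulVec_add, sub_sub_sub_cancel_left,
      ← mulVec_sub, ← mulVec_neg]
    congr 1
    rw [hd]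
    ring
  have hD : ∀ j, (1 - t j ^ 2) * d j = t j * (Xᵀ *ᵥ e) j + r j := fun j => by
    simp only [hd, he, hr, mulVec_sub, Pi.sub_apply]
    linear_combination hz j - hz₀ j
  have hadj : (X *ᵥ (t * d)) ⬝ᵥ e = ∑ j, d j * (t j * (Xᵀ *ᵥ e) j) := by
    rw [dotProduct_comm, dotProduct_mulVec, ← mulVec_transpose, dotProduct]
    exact Finset.sum_congr rfl fun j _ => by simp only [Pi.mul_apply]; ring
  have hbound : -∑ j, d j * (t j * (Xᵀ *ᵥ e) j) ≤ ∑ j, r j ^ 2 / (1 - t j ^ 2) / 4 := by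
    rw [← Finset.sum_neg_distrib]
    refine Finset.sum_le_sum fun j _ => ?_
    rw [div_div, le_div_iff₀ (by linarith [ht j])]
    have h1 : t j * (Xᵀ *ᵥ e) j = (1 - t j ^ 2) * d j - r j := by linarith [hD j]
    rw [h1]
    nlinarith [sq_nonneg (2 * (1 - t j ^ 2) * d j - r j)]
  have hen : δ * (e ⬝ᵥ e) = -((X *ᵥ (t * d)) ⬝ᵥ e) - p ⬝ᵥ e := by
    rw [← smul_eq_mul, ← smul_dotProduct, hE, sub_dotProduct, neg_dotProduct]
  have hsq : 0 ≤ (δ • e + p) ⬝ᵥ (δ • e + p) := by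
    simpa using dotProduct_star_self_nonneg (δ • e + p)
  simp only [add_dotProduct, dotProduct_add, smul_dotProduct, dotProduct_smul, smul_eq_mul,
    dotProduct_comm e p] at hsq
  rw [← Finset.sum_div] at hbound
  have hnn : 0 ≤ ∑ j, r j ^ 2 / (1 - t j ^ 2) :=
    Finset.sum_nonneg fun j _ => div_nonneg (sq_nonneg _) (ht j).le
  have hmain : δ * (e ⬝ᵥ e) ≤ (∑ j, r j ^ 2 / (1 - t j ^ 2)) / 4 - p ⬝ᵥ e := by linarith
  nlinarith [mul_le_mul_of_nonneg_left hmain hδ.le, mul_nonneg hδ.le hnn]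

/-- The scalar error terms in `residual_stability` vanish in the limit, also when `a = 1`. -/
lemma tendsto_error_term {ι : Type*} {l : Filter ι} {s : ι → ℝ} {a g z : ℝ}
    (ha : a ∈ Set.Icc (0 : ℝ) 1) (hs : Tendsto s l (𝓝 a)) (hs1 : ∀ᶠ i in l, s i ∈ Set.Ico (0 : ℝ) 1)
    (hz : (1 - a ^ 2) * z = a * g) :
    Tendsto (fun i => ((s i - a) * (g + (s i + a) * z)) ^ 2 / (1 - s i ^ 2)) l (𝓝 0) := by
  rcases eq_or_lt_of_le ha.2 with rfl | h
  · have hg : g = 0 := by linarith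
    have hlim : Tendsto (fun i => (1 - s i ^ 2) * z ^ 2) l (𝓝 0) := by
      simpa using ((hs.pow 2).const_sub 1).mul_const (z ^ 2)
    refine hlim.congr' ?_
    filter_upwards [hs1] with i hi
    have : 1 - s i ^ 2 ≠ 0 := by nlinarith [hi.1, hi.2]
    rw [hg]
    field_simp
    ring
  · have hne : 1 - a ^ 2 ≠ 0 := by nlinarith [ha.1]
    have hlim := ((((hs.sub_const a).mul
      (((hs.add_const a).mul_const z).const_add g)).pow 2).div ((hs.pow 2).const_sub 1) hne)
    simpa [Pi.div_def] using hlim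

/-- The ridge projection applied to a vector has a limit at every point of the closed cube. -/
lemma exists_tendsto_mulVec {m n : ℕ} (X : Matrix (Fin m) (Fin n) ℝ) {δ : ℝ} (hδ : 0 < δ)
    {t₀ : Fin n → ℝ} (ht₀ : ∀ j, t₀ j ∈ Set.Icc (0 : ℝ) 1) (u : Fin m → ℝ) (i : Fin m) :
    ∃ y, Tendsto (fun t : Fin n → ℝ => ((X * diagonal t *
      (diagonal t * (Xᵀ * X) * diagonal t + δ • (1 - diagonal t ^ 2))⁻¹ *
        diagonal t * Xᵀ) *ᵥ u) i)
      (𝓝[{t | ∀ j, t j ∈ Set.Ico (0 : ℝ) 1}] t₀) (𝓝 y) := by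
  set A : Set (Fin n → ℝ) := {t | ∀ j, t j ∈ Set.Ico (0 : ℝ) 1}
  set K : (Fin n → ℝ) → Matrix (Fin n) (Fin n) ℝ := fun t =>
    diagonal t * (Xᵀ * X) * diagonal t + δ • (1 - diagonal t ^ 2) with hK
  obtain ⟨z₀, hz₀⟩ : ∃ z₀, K t₀ *ᵥ z₀ = (X * diagonal t₀)ᵀ *ᵥ u := by
    simp only [hK, system_matrix_eq]
    exact exists_ridge_solution _ _
      (fun j => mul_nonneg hδ.le (by nlinarith [(ht₀ j).1, (ht₀ j).2])) u
  set z : (Fin n → ℝ) → Fin n → ℝ := fun t => (K t)⁻¹ *ᵥ ((X * diagonal t)ᵀ *ᵥ u) with hz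
  set v : (Fin n → ℝ) → Fin m → ℝ := fun t => δ⁻¹ • (u - X *ᵥ (t * z t)) with hv
  set v₀ : Fin m → ℝ := δ⁻¹ • (u - X *ᵥ (t₀ * z₀)) with hv₀
  have hδv : ∀ t, δ • v t = u - X *ᵥ (t * z t) := fun t => smul_inv_smul₀ hδ.ne' _
  have hδv₀ : δ • v₀ = u - X *ᵥ (t₀ * z₀) := smul_inv_smul₀ hδ.ne' _
  have hpen₀ := penalty_mul_eq_of_ridge_solution X hδ hz₀ hδv₀
  have hP : ∀ t, ((X * diagonal t * (K t)⁻¹ * diagonal t * Xᵀ) *ᵥ u) i = u i - δ * v t i := by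
    intro t
    have hdiag : diagonal t *ᵥ z t = t * z t := by
      ext j; simp [mulVec_diagonal]
    have h : (X * diagonal t * (K t)⁻¹ * diagonal t * Xᵀ) *ᵥ u = X *ᵥ (t * z t) := by
      rw [← hdiag]
      simp only [hz, mulVec_mulVec, transpose_mul, diagonal_transpose, Matrix.mul_assoc]
    have h' := congrFun (hδv t) i
    simp only [Pi.smul_apply, Pi.sub_apply, smul_eq_mul] at h'
    rw [h]
    linarith
  have hcoord : ∀ j, Tendsto (fun t : Fin n → ℝ => t j) (𝓝[A] t₀) (𝓝 (t₀ j)) := fun j =>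
    ((continuous_apply j).tendsto t₀).mono_left nhdsWithin_le_nhds
  have herr : Tendsto (fun t : Fin n → ℝ => (δ * ∑ j, ((t j - t₀ j) *
      ((Xᵀ *ᵥ v₀) j + (t j + t₀ j) * z₀ j)) ^ 2 / (1 - t j ^ 2) +
        (X *ᵥ ((t - t₀) * z₀)) ⬝ᵥ (X *ᵥ ((t - t₀) * z₀))) / δ ^ 2) (𝓝[A] t₀) (𝓝 0) := by
    have hsum := tendsto_finsetSum Finset.univ fun j _ => tendsto_error_term (ht₀ j) (hcoord j)
      (eventually_mem_nhdsWithin.mono fun t (ht : t ∈ A) => ht j) (hpen₀ j)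
    have hp : Tendsto (fun t : Fin n → ℝ => (X *ᵥ ((t - t₀) * z₀)) ⬝ᵥ (X *ᵥ ((t - t₀) * z₀)))
        (𝓝[A] t₀) (𝓝 0) := by
      have hc : Continuous fun t : Fin n → ℝ =>
          (X *ᵥ ((t - t₀) * z₀)) ⬝ᵥ (X *ᵥ ((t - t₀) * z₀)) := by
        fun_prop
      simpa using (hc.tendsto t₀).mono_left nhdsWithin_le_nhds
    simpa using ((hsum.const_mul δ).add hp).div_const (δ ^ 2)
  have hsq : Tendsto (fun t => (v t i - v₀ i) ^ 2) (𝓝[A] t₀) (𝓝 0) := by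
    refine squeeze_zero' (Eventually.of_forall fun t => sq_nonneg _) ?_ herr
    filter_upwards [eventually_mem_nhdsWithin] with t ht
    have hzt : K t *ᵥ z t = (X * diagonal t)ᵀ *ᵥ u := by
      rw [hz, mulVec_mulVec, mul_nonsing_inv _ (isUnit_det_system_matrix X hδ ht), one_mulVec]
    have hst := residual_stability X hδ
      (fun j => by nlinarith [(ht j).1, (ht j).2]) (hδv t) hδv₀
      (penalty_mul_eq_of_ridge_solution X hδ hzt (hδv t)) hpen₀
    rw [le_div_iff₀ (by positivity), mul_comm]
    refine le_trans (mul_le_mul_of_nonneg_left ?_ (by positivity)) hst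
    rw [sq]
    exact Finset.single_le_sum (f := fun k => (v t - v₀) k * (v t - v₀) k)
      (fun k _ => mul_self_nonneg _) (Finset.mem_univ i)
  have hlim : Tendsto (fun t => v t i - v₀ i) (𝓝[A] t₀) (𝓝 0) := by
    rw [tendsto_zero_iff_abs_tendsto_zero]
    simpa [Function.comp_def, Real.sqrt_sq_eq_abs] using hsq.sqrt
  refine ⟨u i - δ * v₀ i, ?_⟩
  refine Tendsto.congr (fun t => (hP t).symm) ?_
  exact ((tendsto_sub_nhds_zero_iff.mp hlim).const_mul δ).const_sub (u i)

/-- The map `t ↦ P̃(t) = X T (T Xᵀ X T + δ(I − T²))⁻¹ T Xᵀ` defined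
on `[0,1)ⁿ` extends to a continuous (entrywise) function on the whole
hypercube `[0,1]ⁿ`. -/
theorem stmt_2 {m n : ℕ} (X : Matrix (Fin m) (Fin n) ℝ) (δ : ℝ) (hδ : 0 < δ) :
    ∃ F : (Fin n → ℝ) → Matrix (Fin m) (Fin m) ℝ,
      ContinuousOn F (Set.Icc (0 : Fin n → ℝ) 1) ∧
      ∀ t : Fin n → ℝ, (∀ j, t j ∈ Set.Ico (0 : ℝ) 1) →
        F t = X * Matrix.diagonal t *
            (Matrix.diagonal t * (Xᵀ * X) * Matrix.diagonal t
              + δ • (1 - Matrix.diagonal t ^ 2))⁻¹ *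
            Matrix.diagonal t * Xᵀ := by
  set A : Set (Fin n → ℝ) := {t | ∀ j, t j ∈ Set.Ico (0 : ℝ) 1} with hA
  set P : (Fin n → ℝ) → Matrix (Fin m) (Fin m) ℝ := fun t => X * Matrix.diagonal t *
    (Matrix.diagonal t * (Xᵀ * X) * Matrix.diagonal t
      + δ • (1 - Matrix.diagonal t ^ 2))⁻¹ * Matrix.diagonal t * Xᵀ with hP
  have hlim : ∀ t₀ ∈ Set.Icc (0 : Fin n → ℝ) 1, ∃ L, Tendsto P (𝓝[A] t₀) (𝓝 L) := by
    intro t₀ ht₀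
    choose L hL using fun i k =>
      exists_tendsto_mulVec X hδ (fun j => ⟨ht₀.1 j, ht₀.2 j⟩) (Pi.single k 1) i
    refine ⟨L, tendsto_pi_nhds.2 fun i => tendsto_pi_nhds.2 fun k => ?_⟩
    simpa only [mulVec_single_one, col_apply] using hL i k
  have hclosure : Set.Icc (0 : Fin n → ℝ) 1 ⊆ closure A := by
    have hpi : A = Set.univ.pi fun _ => Set.Ico (0 : ℝ) 1 := by ext; simp [hA]
    rw [hpi, closure_pi_set, closure_Ico zero_ne_one]
    exact fun t ht j _ => ⟨ht.1 j, ht.2 j⟩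
  refine ⟨extendFrom A P, continuousOn_extendFrom hclosure hlim, fun t ht => ?_⟩
  have htA : t ∈ A := ht
  obtain ⟨L, hL⟩ := hlim t ⟨fun j => (ht j).1, fun j => (ht j).2.le⟩
  have hLP : L = P t :=
    tendsto_nhds_unique (hL.mono_left (pure_le_nhdsWithin htA)) (tendsto_pure_nhds P t)
  exact (extendFrom_eq (subset_closure htA) hL).trans hLP
end

section
/- Let X be an m×n real matrix, δ > 0, λ ∈ ℝ, K = XᵀX, Z = K − δI, and for t ∈ (0,1)ⁿ let L_t = T Z T + δI and f_λ(t) = −tr(K T L_t⁻¹ T K) + λ Σⱼ tⱼ. Then f_λ is differentiable at every t ∈ (0,1)ⁿ and its gradient is ∇f_λ(t) = 2 Diag[L_t⁻¹ T K² (T L_t⁻¹ T Z − I)] + λ𝟙; equivalently, for each j = 1,…,n, ∂f_λ/∂t_j(t) = 2[L_t⁻¹ T K² (T L_t⁻¹ T Z − I)]_{jj} + λ. -/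
open Matrix

/-- Derivative of `s ↦ φ (A D(s) (D(s) Z D(s) + C)⁻¹ D(s) B)` in a complete normed algebra, for
continuous linear maps `φ` and `D`. -/
lemma hasFDerivAt_comp_mul_ringInverse {E R F : Type*} [NormedAddCommGroup E] [NormedSpace ℝ E]
    [NormedRing R] [NormedAlgebra ℝ R] [CompleteSpace R] [NormedAddCommGroup F] [NormedSpace ℝ F]
    (D : E →L[ℝ] R) (φ : R →L[ℝ] F) (A B C Z : R) (t : E) (h : IsUnit (D t * Z * D t + C)) :
    ∃ g : E →L[ℝ] F,
      HasFDerivAt (fun s => φ (A * D s * Ring.inverse (D s * Z * D s + C) * D s * B)) g t ∧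
      ∀ e, g e = φ
        (A * D e * Ring.inverse (D t * Z * D t + C) * D t * B
          - A * D t * (Ring.inverse (D t * Z * D t + C) * (D e * Z * D t + D t * Z * D e) *
              Ring.inverse (D t * Z * D t + C)) * D t * B
          + A * D t * Ring.inverse (D t * Z * D t + C) * D e * B) := by
  have hD : HasFDerivAt (fun s => D s) D t := D.hasFDerivAt
  have hL := ((hD.mul_const' Z).mul' hD).add_const C
  obtain ⟨u, hu⟩ := h
  have hI := hasFDerivAt_ringInverse (𝕜 := ℝ) u
  rw [hu] at hI
  have hP := hI.comp t hL
  have hF := φ.hasFDerivAt.comp t ((((hD.const_mul A).mul' hP).mul' hD).mul_const' B)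
  have huinv : (↑u⁻¹ : R) = Ring.inverse (D t * Z * D t + C) := by
    rw [← hu, Ring.inverse_unit]
  refine ⟨_, hF, fun e => ?_⟩
  rw [ContinuousLinearMap.comp_apply]
  congr 1
  simp [huinv]
  noncomm_ring

section Calculus

attribute [local instance] Matrix.linftyOpNormedRing Matrix.linftyOpNormedAlgebra

/-- Derivative at `t` in the direction `e` of `t ↦ tr (A T (T Z T + C)⁻¹ T B)`, `T = Diag(t)`. -/
lemma exists_hasFDerivAt_trace_diagonal_inv {n : Type*} [Fintype n] [DecidableEq n]
    (A B C Z : Matrix n n ℝ) (t : n → ℝ) (h : IsUnit (diagonal t * Z * diagonal t + C)) :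
    ∃ g : (n → ℝ) →L[ℝ] ℝ,
      HasFDerivAt (fun s : n → ℝ =>
        (A * diagonal s * (diagonal s * Z * diagonal s + C)⁻¹ * diagonal s * B).trace) g t ∧
      ∀ e, g e =
        (A * diagonal e * (diagonal t * Z * diagonal t + C)⁻¹ * diagonal t * B
          - A * diagonal t * ((diagonal t * Z * diagonal t + C)⁻¹ *
              (diagonal e * Z * diagonal t + diagonal t * Z * diagonal e) *
              (diagonal t * Z * diagonal t + C)⁻¹) * diagonal t * B
          + A * diagonal t * (diagonal t * Z * diagonal t + C)⁻¹ * diagonal e * B).trace := by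
  simp only [nonsing_inv_eq_ringInverse]
  exact hasFDerivAt_comp_mul_ringInverse
    (LinearMap.toContinuousLinearMap (diagonalLinearMap n ℝ ℝ))
    (LinearMap.toContinuousLinearMap (traceLinearMap n ℝ ℝ)) A B C Z t h

end Calculus

/-- `T (XᵀX - δI) T + δI = T XᵀX T + δ(I - T²)` is positive definite for `t ∈ (0,1)ⁿ`. -/
lemma posDef_diagonal_gram {m n : Type*} [Fintype m] [Fintype n] [DecidableEq n]
    (X : Matrix m n ℝ) {δ : ℝ} (hδ : 0 < δ) {t : n → ℝ} (ht : ∀ j, t j ∈ Set.Ioo (0 : ℝ) 1) :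
    (diagonal t * (Xᵀ * X - δ • 1) * diagonal t + δ • 1).PosDef := by
  have h₁ : (diagonal fun j => δ * (1 - t j * t j)).PosDef :=
    PosDef.diagonal fun j => mul_pos hδ (by nlinarith [(ht j).1, (ht j).2])
  have h₂ := posSemidef_conjTranspose_mul_self (X * diagonal t)
  convert h₁.add_posSemidef h₂ using 1
  have h₃ : (diagonal fun j => δ * (1 - t j * t j)) = δ • 1 - δ • (diagonal t * diagonal t) := by
    ext i j
    by_cases hij : i = j
    · subst hij; simp [mul_sub]
    · simp [hij]
  rw [h₃, conjTranspose_mul, diagonal_conjTranspose, conjTranspose_eq_transpose_of_trivial,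
    star_trivial]
  simp only [mul_sub, sub_mul, mul_smul_comm, smul_mul_assoc, mul_one, Matrix.mul_assoc]
  abel

/-- Cyclicity and transposition reduce the directional derivative to a single trace. -/
lemma trace_directional_eq {n : Type*} [Fintype n] {R : Type*} [CommRing R]
    {K T P Z E : Matrix n n R} (hK : Kᵀ = K) (hT : Tᵀ = T) (hP : Pᵀ = P) (hZ : Zᵀ = Z)
    (hE : Eᵀ = E) :
    (K * E * P * T * K - K * T * (P * (E * Z * T + T * Z * E) * P) * T * K
        + K * T * P * E * K).trace =
      2 * (P * T * (K * K) * E).trace - 2 * (P * T * (K * K) * (T * P * T * Z) * E).trace := by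
  have h₁ : (K * E * P * T * K).trace = (P * T * (K * K) * E).trace := by
    rw [show K * E * P * T * K = (K * E) * (P * T * K) by simp only [Matrix.mul_assoc],
      trace_mul_comm]
    simp only [Matrix.mul_assoc]
  have h₂ : (K * T * P * E * K).trace = (K * E * P * T * K).trace := by
    rw [← trace_transpose]
    simp only [transpose_mul, hK, hT, hP, hE, Matrix.mul_assoc]
  have h₃ : (K * T * P * T * Z * E * P * T * K).trace =
      (P * T * (K * K) * (T * P * T * Z) * E).trace := by
    rw [show K * T * P * T * Z * E * P * T * K = (K * T * P * T * Z * E) * (P * T * K) by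
      simp only [Matrix.mul_assoc], trace_mul_comm]
    simp only [Matrix.mul_assoc]
  have h₄ : (K * T * P * E * Z * T * P * T * K).trace =
      (K * T * P * T * Z * E * P * T * K).trace := by
    rw [← trace_transpose]
    simp only [transpose_mul, hK, hT, hP, hE, hZ, Matrix.mul_assoc]
  have h₅ : K * T * (P * (E * Z * T + T * Z * E) * P) * T * K =
      K * T * P * E * Z * T * P * T * K + K * T * P * T * Z * E * P * T * K := by
    simp only [mul_add, add_mul, Matrix.mul_assoc]
  rw [trace_add, trace_sub, h₅, trace_add, h₄, h₃, h₂, h₁]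
  ring

/-- The trace of `M Diag(eⱼ)` is the `j`-th diagonal entry of `M`. -/
lemma trace_mul_diagonal_single {n : Type*} [Fintype n] [DecidableEq n] {R : Type*} [Semiring R]
    (M : Matrix n n R) (j : n) : (M * diagonal (Pi.single j 1)).trace = M j j := by
  simp [trace, mul_diagonal, Pi.single_apply]



/-- With `K = XᵀX`, `Z = K − δI`, `L_t = T Z T + δI` and
`f_λ(t) = −tr(K T L_t⁻¹ T K) + λ Σⱼ tⱼ`, the function `f_λ` is differentiable
at every `t ∈ (0,1)ⁿ` with partial derivatives
`∂f_λ/∂t_j(t) = 2 [L_t⁻¹ T K² (T L_t⁻¹ T Z − I)]_{jj} + λ`. -/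
theorem stmt_3 {m n : ℕ} (X : Matrix (Fin m) (Fin n) ℝ)
    (δ : ℝ) (hδ : 0 < δ) (lam : ℝ)
    (K Z : Matrix (Fin n) (Fin n) ℝ)
    (hK : K = Xᵀ * X) (hZ : Z = K - δ • 1)
    (L : (Fin n → ℝ) → Matrix (Fin n) (Fin n) ℝ)
    (hL : ∀ t, L t = Matrix.diagonal t * Z * Matrix.diagonal t + δ • 1)
    (f : (Fin n → ℝ) → ℝ)
    (hf : ∀ t, f t =
      -(K * Matrix.diagonal t * (L t)⁻¹ * Matrix.diagonal t * K).trace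
        + lam * ∑ j, t j)
    (t : Fin n → ℝ) (ht : ∀ j, t j ∈ Set.Ioo (0 : ℝ) 1) :
    DifferentiableAt ℝ f t ∧
      ∀ j, fderiv ℝ f t (Pi.single j 1) =
        2 * Matrix.diag ((L t)⁻¹ * Matrix.diagonal t * K ^ 2 *
              (Matrix.diagonal t * (L t)⁻¹ * Matrix.diagonal t * Z - 1)) j
          + lam := by
  obtain rfl : L = fun t => diagonal t * Z * diagonal t + δ • 1 := funext hL
  obtain rfl := funext hf
  have hpos : (diagonal t * Z * diagonal t + δ • 1).PosDef := by
    rw [hZ, hK]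
    exact posDef_diagonal_gram X hδ ht
  obtain ⟨g, hg, hge⟩ := exists_hasFDerivAt_trace_diagonal_inv K K (δ • 1) Z t hpos.isUnit
  have hsum : HasFDerivAt (fun s : Fin n → ℝ => ∑ j, s j)
      (∑ j, ContinuousLinearMap.proj (R := ℝ) (φ := fun _ : Fin n => ℝ) j) t :=
    HasFDerivAt.fun_sum fun j _ => hasFDerivAt_apply j t
  have hF := hg.fun_neg.fun_add (hsum.const_mul lam)
  refine ⟨hF.differentiableAt, fun j => ?_⟩
  have hKt : Kᵀ = K := by simp [hK]
  have hZt : Zᵀ = Z := by simp [hZ, hKt]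
  have hPt : ((diagonal t * Z * diagonal t + δ • 1)⁻¹)ᵀ
      = (diagonal t * Z * diagonal t + δ • 1)⁻¹ := by
    simp [transpose_nonsing_inv, hZt, Matrix.mul_assoc]
  rw [hF.fderiv]
  simp only [_root_.add_apply, _root_.neg_apply, _root_.smul_apply, hge,
    _root_.sum_apply, ContinuousLinearMap.proj_apply, smul_eq_mul]
  rw [trace_directional_eq hKt (diagonal_transpose _) hPt hZt (diagonal_transpose _),
    trace_mul_diagonal_single, trace_mul_diagonal_single]
  simp only [mul_sub, mul_one, diag_apply, Matrix.sub_apply, pow_two, Finset.sum_pi_single',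
    Finset.mem_univ, if_true]
  simp
end

section
/- Let K be an n×n real symmetric positive semidefinite matrix and δ > 0. Then there exists a continuous function G from the hypercube [0,1]ⁿ to the n×n real matrices such that G(t) = K T (T K T + δ(I − T²))⁻¹ T K for every t ∈ [0,1)ⁿ. In other words, the map t ↦ K̃(t) defined on [0,1)ⁿ extends continuously (entrywise) to all of [0,1]ⁿ. -/
open Matrix Filter Topology

open scoped MatrixOrder Matrix.Norms.L2Operator in
/-- A real positive semidefinite matrix is a Gram matrix. -/
theorem exists_eq_transpose_mul_self_of_posSemidef {n : Type*} [Fintype n] [DecidableEq n]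
    {K : Matrix n n ℝ} (hK : K.PosSemidef) : ∃ B : Matrix n n ℝ, K = Bᵀ * B := by
  obtain ⟨B, hB⟩ := CStarAlgebra.nonneg_iff_eq_star_mul_self.1 hK.nonneg
  exact ⟨B, by simpa [star_eq_conjTranspose] using hB⟩

/-- The normal equations `Aᵀ A w = Aᵀ x` are always solvable. -/
theorem exists_transpose_mul_self_mulVec_eq {m n : Type*} [Fintype m] [Fintype n]
    (A : Matrix m n ℝ) (x : m → ℝ) : ∃ w : n → ℝ, (Aᵀ * A) *ᵥ w = Aᵀ *ᵥ x := by
  classical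
  have hle : LinearMap.range (Aᵀ * A).mulVecLin ≤ LinearMap.range Aᵀ.mulVecLin := by
    rintro _ ⟨w, rfl⟩
    exact ⟨A *ᵥ w, by simp⟩
  have heq := Submodule.eq_of_le_of_finrank_eq hle
    (show (Aᵀ * A).rank = Aᵀ.rank by rw [rank_transpose_mul_self, rank_transpose])
  have hx : Aᵀ *ᵥ x ∈ LinearMap.range (Aᵀ * A).mulVecLin := heq ▸ ⟨x, rfl⟩
  exact hx

/-- Solvability of the regularized normal equations, with a possibly degenerate regularization. -/
theorem exists_regularized_normal_equation {m n : Type*} [Fintype m] [Fintype n] [DecidableEq n]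
    (C : Matrix m n ℝ) (D : n → ℝ) (hD : ∀ i, 0 ≤ D i) (x : m → ℝ) :
    ∃ w : n → ℝ, (Cᵀ * C + diagonal D) *ᵥ w = Cᵀ *ᵥ x := by
  obtain ⟨w, hw⟩ := exists_transpose_mul_self_mulVec_eq
    (fromRows C (diagonal fun i => √(D i))) (Sum.elim x 0)
  refine ⟨w, ?_⟩
  simpa [transpose_fromRows, fromCols_mul_fromRows, fromCols_mulVec_sumElim,
    diagonal_mul_diagonal, Real.mul_self_sqrt (hD _)] using hw

/-- Stability estimate for the fitted value of a regularized least squares problem. -/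
theorem regularized_fit_estimate {m n : Type*} [Fintype m] [Fintype n] [DecidableEq n]
    (B : Matrix m n ℝ) (t D w v z : n → ℝ) (q x : m → ℝ) (hD : ∀ i, 0 < D i)
    (hw : ((B * diagonal t)ᵀ * (B * diagonal t) + diagonal D) *ᵥ w = (B * diagonal t)ᵀ *ᵥ x)
    (hz : z = Bᵀ *ᵥ (x - (B * diagonal t) *ᵥ v + q)) :
    ((B * diagonal t) *ᵥ (w - v)) ⬝ᵥ ((B * diagonal t) *ᵥ (w - v)) ≤
      q ⬝ᵥ q + ∑ i, (D i * v i - t i * z i) ^ 2 / D i := by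
  set C := B * diagonal t with hC
  set d := w - v with hd
  have htz : diagonal t *ᵥ z = Cᵀ *ᵥ (x - C *ᵥ v + q) := by
    rw [hz, hC, transpose_mul, diagonal_transpose, mulVec_mulVec]
  have hMd : Cᵀ *ᵥ (C *ᵥ d) + diagonal D *ᵥ d
      = diagonal t *ᵥ z - Cᵀ *ᵥ q - diagonal D *ᵥ v := by
    rw [add_mulVec, ← mulVec_mulVec] at hw
    rw [htz, hd]
    simp only [mulVec_sub, mulVec_add]
    rw [← hw]
    abel
  have hdot := congrArg (fun y => d ⬝ᵥ y) hMd
  have hadj : ∀ y, d ⬝ᵥ (Cᵀ *ᵥ y) = (C *ᵥ d) ⬝ᵥ y := by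
    intro y
    rw [dotProduct_mulVec, vecMul_transpose]
  simp only [dotProduct_add, dotProduct_sub, hadj] at hdot
  set g := C *ᵥ d
  have hgq : 0 ≤ (g + q) ⬝ᵥ (g + q) := by
    simpa [dotProduct] using Finset.sum_nonneg fun i _ => mul_self_nonneg ((g + q) i)
  simp only [dotProduct_add, add_dotProduct, dotProduct_comm q g] at hgq
  have hsum : d ⬝ᵥ (diagonal t *ᵥ z) - d ⬝ᵥ (diagonal D *ᵥ v) - d ⬝ᵥ (diagonal D *ᵥ d)
      ≤ (∑ i, (D i * v i - t i * z i) ^ 2 / D i) / 2 := by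
    simp only [dotProduct, mulVec_diagonal, ← Finset.sum_sub_distrib, Finset.sum_div]
    refine Finset.sum_le_sum fun i _ => ?_
    rw [div_div, le_div_iff₀ (by have := hD i; positivity)]
    nlinarith [sq_nonneg (D i * d i + (D i * v i - t i * z i)), sq_nonneg (D i * d i)]
  linarith

theorem tendsto_zero_of_dotProduct_self {α m : Type*} [Fintype m] {l : Filter α}
    {g : α → m → ℝ} (h : Tendsto (fun a => g a ⬝ᵥ g a) l (𝓝 0)) : Tendsto g l (𝓝 0) := by
  refine tendsto_pi_nhds.2 fun i => ?_
  have hsq : Tendsto (fun a => g a i ^ 2) l (𝓝 0) := by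
    refine squeeze_zero (fun a => sq_nonneg _) (fun a => ?_) h
    rw [sq]
    exact Finset.single_le_sum (f := fun j => g a j * g a j)
      (fun j _ => mul_self_nonneg _) (Finset.mem_univ i)
  have := hsq.sqrt
  simp only [Real.sqrt_sq_eq_abs, Real.sqrt_zero] at this
  exact tendsto_zero_iff_abs_tendsto_zero _ |>.2 this

/-- The fitted value of the regularized least squares problem has a limit at every point of the
closed cube. -/
theorem exists_tendsto_regularized_fit {m n : Type*} [Fintype m] [Fintype n] [DecidableEq n]
    (B : Matrix m n ℝ) {δ : ℝ} (hδ : 0 < δ) (x : m → ℝ) {s : n → ℝ}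
    (hs : s ∈ Set.Icc (0 : n → ℝ) 1) (w : (n → ℝ) → n → ℝ)
    (hw : ∀ t ∈ Set.univ.pi fun _ : n => Set.Ico (0 : ℝ) 1,
      ((B * diagonal t)ᵀ * (B * diagonal t) + diagonal fun i => δ * (1 - t i ^ 2)) *ᵥ w t =
        (B * diagonal t)ᵀ *ᵥ x) :
    ∃ y, Tendsto (fun t => (B * diagonal t) *ᵥ w t)
      (𝓝[Set.univ.pi fun _ : n => Set.Ico (0 : ℝ) 1] s) (𝓝 y) := by
  have hs1 : ∀ i, s i ^ 2 ≤ 1 := fun i => pow_le_one₀ (hs.1 i) (hs.2 i)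
  obtain ⟨v, hv⟩ := exists_regularized_normal_equation (B * diagonal s)
    (fun i => δ * (1 - s i ^ 2)) (fun i => mul_nonneg hδ.le (sub_nonneg.2 (hs1 i))) x
  set z := Bᵀ *ᵥ (x - (B * diagonal s) *ᵥ v) with hz
  have hvz : ∀ i, δ * (1 - s i ^ 2) * v i = s i * z i := by
    intro i
    have h : diagonal (fun i => δ * (1 - s i ^ 2)) *ᵥ v = diagonal s *ᵥ z := by
      rw [add_mulVec, ← mulVec_mulVec] at hv
      rw [hz, mulVec_mulVec, ← diagonal_transpose s, ← transpose_mul, diagonal_transpose,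
        mulVec_sub, ← hv]
      abel
    simpa [mulVec_diagonal] using congrFun h i
  have hcont : Continuous fun t : n → ℝ => (B * diagonal t) *ᵥ v := by fun_prop
  have hfit : Tendsto (fun t : n → ℝ => (B * diagonal t) *ᵥ v)
      (𝓝[Set.univ.pi fun _ : n => Set.Ico (0 : ℝ) 1] s) (𝓝 ((B * diagonal s) *ᵥ v)) :=
    hcont.continuousAt.mono_left nhdsWithin_le_nhds
  have hterm : ∀ i, Tendsto (fun t : n → ℝ =>
      (δ * (1 - t i ^ 2) * v i - t i * z i) ^ 2 / (δ * (1 - t i ^ 2))) (𝓝 s) (𝓝 0) := by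
    intro i
    by_cases hi : δ * (1 - s i ^ 2) = 0
    · have hzi : z i = 0 := by
        have h := hvz i
        rw [hi, zero_mul, eq_comm, mul_eq_zero] at h
        refine h.resolve_left fun h0 => ?_
        rw [h0] at hi
        simp [hδ.ne'] at hi
      have hc : Continuous fun t : n → ℝ => δ * (1 - t i ^ 2) * v i ^ 2 := by fun_prop
      have h := hc.tendsto s
      rw [hi, zero_mul] at h
      refine h.congr fun t => ?_
      rw [hzi]
      by_cases ht : δ * (1 - t i ^ 2) = 0
      · simp [ht]
      · rw [eq_div_iff ht]
        ring
    · have hc : Continuous fun t : n → ℝ => δ * (1 - t i ^ 2) := by fun_prop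
      have h : ContinuousAt (fun t : n → ℝ =>
          (δ * (1 - t i ^ 2) * v i - t i * z i) ^ 2 / (δ * (1 - t i ^ 2))) s :=
        ContinuousAt.div (by fun_prop) hc.continuousAt hi
      simpa [ContinuousAt, hvz i] using h
  refine ⟨(B * diagonal s) *ᵥ v, ?_⟩
  have hg : Tendsto (fun t => (B * diagonal t) *ᵥ (w t - v))
      (𝓝[Set.univ.pi fun _ : n => Set.Ico (0 : ℝ) 1] s) (𝓝 0) := by
    apply tendsto_zero_of_dotProduct_self
    have hbound : Tendsto (fun t : n → ℝ =>
        ((B * diagonal t) *ᵥ v - (B * diagonal s) *ᵥ v) ⬝ᵥ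
          ((B * diagonal t) *ᵥ v - (B * diagonal s) *ᵥ v) +
        ∑ i, (δ * (1 - t i ^ 2) * v i - t i * z i) ^ 2 / (δ * (1 - t i ^ 2)))
        (𝓝[Set.univ.pi fun _ : n => Set.Ico (0 : ℝ) 1] s) (𝓝 0) := by
      have hc : Continuous fun t : n → ℝ =>
        ((B * diagonal t) *ᵥ v - (B * diagonal s) *ᵥ v) ⬝ᵥ
          ((B * diagonal t) *ᵥ v - (B * diagonal s) *ᵥ v) := by fun_prop
      have h := (hc.tendsto s).add (tendsto_finsetSum Finset.univ fun i _ => hterm i)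
      simp only [sub_self, dotProduct_zero, Finset.sum_const_zero, add_zero] at h
      exact h.mono_left nhdsWithin_le_nhds
    refine tendsto_of_tendsto_of_tendsto_of_le_of_le' tendsto_const_nhds hbound
      (Eventually.of_forall fun t => Finset.sum_nonneg fun i _ => mul_self_nonneg _) ?_
    filter_upwards [self_mem_nhdsWithin] with t ht
    refine regularized_fit_estimate B t _ (w t) v z _ x (fun i => ?_) (hw t ht) ?_
    · have := ht i trivial
      exact mul_pos hδ (by nlinarith [this.1, this.2])
    · rw [hz]
      congr 1
      abel
  have h := hg.add hfit
  rw [zero_add] at h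
  refine h.congr fun t => ?_
  rw [← mulVec_add, sub_add_cancel]

/-- For a symmetric PSD matrix `K` and `δ > 0`, the map
`t ↦ K̃(t) = K T (T K T + δ(I − T²))⁻¹ T K` defined on `[0,1)ⁿ` extends to a
continuous (entrywise) function on the whole hypercube `[0,1]ⁿ`. -/
theorem stmt_5 {n : ℕ} (K : Matrix (Fin n) (Fin n) ℝ) (hK : K.PosSemidef)
    (δ : ℝ) (hδ : 0 < δ) :
    ∃ G : (Fin n → ℝ) → Matrix (Fin n) (Fin n) ℝ,
      ContinuousOn G (Set.Icc (0 : Fin n → ℝ) 1) ∧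
      ∀ t : Fin n → ℝ, (∀ j, t j ∈ Set.Ico (0 : ℝ) 1) →
        G t = K * Matrix.diagonal t *
            (Matrix.diagonal t * K * Matrix.diagonal t
              + δ • (1 - Matrix.diagonal t ^ 2))⁻¹ *
            Matrix.diagonal t * K := by
  obtain ⟨B, hB⟩ := exists_eq_transpose_mul_self_of_posSemidef hK
  set A : Set (Fin n → ℝ) := Set.univ.pi fun _ => Set.Ico (0 : ℝ) 1
  set M : (Fin n → ℝ) → Matrix (Fin n) (Fin n) ℝ := fun t =>
    (B * diagonal t)ᵀ * (B * diagonal t) + diagonal fun i => δ * (1 - t i ^ 2) with hM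
  have hMeq : ∀ t, diagonal t * K * diagonal t + δ • (1 - diagonal t ^ 2) = M t := by
    intro t
    have h : δ • (1 - diagonal t ^ 2) = diagonal fun i => δ * (1 - t i ^ 2) := by
      rw [diagonal_pow, ← diagonal_one, diagonal_sub, ← diagonal_smul]
      rfl
    simp only [h, hM, hB, transpose_mul, diagonal_transpose, Matrix.mul_assoc]
  have hMdet : ∀ t ∈ A, IsUnit (M t).det := by
    intro t ht
    have hpos : (M t).PosDef := by
      refine PosDef.posSemidef_add ?_ (PosDef.diagonal fun i => ?_)
      · simpa using posSemidef_conjTranspose_mul_self (B * diagonal t)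
      · have := ht i trivial
        exact mul_pos hδ (by nlinarith [this.1, this.2])
    exact hpos.det_pos.ne'.isUnit
  set P : (Fin n → ℝ) → Matrix (Fin n) (Fin n) ℝ := fun t =>
    (B * diagonal t) * ((M t)⁻¹ * (B * diagonal t)ᵀ) with hP
  set F : (Fin n → ℝ) → Matrix (Fin n) (Fin n) ℝ := fun t =>
    K * diagonal t * (diagonal t * K * diagonal t + δ • (1 - diagonal t ^ 2))⁻¹ *
      diagonal t * K with hF
  have hFP : ∀ t, F t = Bᵀ * P t * B := by
    intro t
    simp only [hF, hP]
    rw [hMeq, hB, transpose_mul, diagonal_transpose]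
    simp only [Matrix.mul_assoc]
  have hPlim : ∀ s ∈ Set.Icc (0 : Fin n → ℝ) 1, ∃ Y, Tendsto P (𝓝[A] s) (𝓝 Y) := by
    intro s hs
    have hcol : ∀ x : Fin n → ℝ, ∃ y, Tendsto (fun t => P t *ᵥ x) (𝓝[A] s) (𝓝 y) := by
      intro x
      obtain ⟨y, hy⟩ := exists_tendsto_regularized_fit B hδ x hs
        (fun t => ((M t)⁻¹ * (B * diagonal t)ᵀ) *ᵥ x) fun t ht => by
          rw [mulVec_mulVec, mul_nonsing_inv_cancel_left _ _ (hMdet t ht)]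
      exact ⟨y, by simpa only [mulVec_mulVec] using hy⟩
    choose y hy using fun j : Fin n => hcol (Pi.single j 1)
    refine ⟨fun i j => y j i, tendsto_pi_nhds.2 fun i => tendsto_pi_nhds.2 fun j => ?_⟩
    simpa using tendsto_pi_nhds.1 (hy j) i
  have hFlim : ∀ s ∈ Set.Icc (0 : Fin n → ℝ) 1, ∃ Y, Tendsto F (𝓝[A] s) (𝓝 Y) := by
    intro s hs
    obtain ⟨Y, hY⟩ := hPlim s hs
    have hc : Continuous fun Z : Matrix (Fin n) (Fin n) ℝ => Bᵀ * Z * B := by fun_prop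
    exact ⟨Bᵀ * Y * B, ((hc.tendsto Y).comp hY).congr fun t => (hFP t).symm⟩
  have hclosure : Set.Icc (0 : Fin n → ℝ) 1 ⊆ closure A := by
    intro s hs
    rw [closure_pi_set]
    intro i _
    rw [closure_Ico zero_ne_one]
    exact ⟨hs.1 i, hs.2 i⟩
  refine ⟨extendFrom A F, continuousOn_extendFrom hclosure hFlim, fun t ht => ?_⟩
  have htA : t ∈ A := fun i _ => ht i
  obtain ⟨Y, hY⟩ := hFlim t ⟨fun i => (ht i).1, fun i => (ht i).2.le⟩
  have hYF : F t = Y :=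
    tendsto_nhds_unique (tendsto_pure_nhds F t) (hY.mono_left (pure_le_nhdsWithin htA))
  rw [extendFrom_eq (subset_closure htA) hY, ← hYF]
end

section
/- Let K be an n×n real symmetric positive semidefinite matrix, δ > 0, λ ∈ ℝ, Z = K − δI, and for t ∈ (0,1)ⁿ let L_t = T Z T + δI, K̃(t) = K T L_t⁻¹ T K, D = K̃(t) − K, and g_λ(t) = ‖K − K̃(t)‖_F² + λ Σⱼ tⱼ. Then g_λ is differentiable at every t ∈ (0,1)ⁿ and its gradient is ∇g_λ(t) = 4 Diag[L_t⁻¹ T K D K (I − T L_t⁻¹ T Z)] + λ𝟙; equivalently, for each j = 1,…,n, ∂g_λ/∂t_j(t) = 4[L_t⁻¹ T K D K (I − T L_t⁻¹ T Z)]_{jj} + λ. -/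
open Matrix

/-- The derivative of `x ↦ ℓ (T x (T x z T x + c)⁻¹ T x)` in a complete normed algebra, for
continuous linear maps `T` and `ℓ`. -/
theorem exists_hasFDerivAt_mul_inverse_mul {A E F : Type*} [NormedRing A] [NormedAlgebra ℝ A]
    [CompleteSpace A] [NormedAddCommGroup E] [NormedSpace ℝ E] [NormedAddCommGroup F]
    [NormedSpace ℝ F] (T : E →L[ℝ] A) (ℓ : A →L[ℝ] F) (z c : A) (x : E) (u : Aˣ)
    (hu : (u : A) = T x * z * T x + c) :
    ∃ M' : E →L[ℝ] F,
      HasFDerivAt (fun y => ℓ (T y * Ring.inverse (T y * z * T y + c) * T y)) M' x ∧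
      ∀ v, M' v = ℓ ((1 - T x * ↑u⁻¹ * T x * z) * T v * (↑u⁻¹ * T x) +
        T x * ↑u⁻¹ * T v * (1 - z * (T x * ↑u⁻¹ * T x))) := by
  have hT : HasFDerivAt (fun y => T y) T x := T.hasFDerivAt
  have hL : HasFDerivAt (fun y => T y * z * T y + c) _ x :=
    ((hT.mul' (hasFDerivAt_const z x)).mul' hT).add_const c
  have hinv := hasFDerivAt_ringInverse (𝕜 := ℝ) u
  rw [hu] at hinv
  have hLi : HasFDerivAt (fun y => Ring.inverse (T y * z * T y + c)) _ x :=
    HasFDerivAt.comp (g := Ring.inverse) (f := fun y => T y * z * T y + c) x hinv hL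
  have hM := ℓ.hasFDerivAt.comp x ((hT.mul' hLi).mul' hT)
  refine ⟨_, hM, fun v => ?_⟩
  have hi : Ring.inverse (T x * z * T x + c) = ↑u⁻¹ := by rw [← hu, Ring.inverse_unit]
  rw [ContinuousLinearMap.comp_apply]
  congr 1
  simp [hi]
  noncomm_ring

section FrechetDerivative

attribute [local instance] Matrix.linftyOpNormedRing Matrix.linftyOpNormedAlgebra

/-- The derivative of the entries of `K T (T Z T + δI)⁻¹ T K`, where `T = diagonal t`. -/
theorem exists_hasFDerivAt_diagonal_mul_inv_mul_diagonal {n : ℕ}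
    (K Z : Matrix (Fin n) (Fin n) ℝ) (δ : ℝ) (t : Fin n → ℝ)
    (h : IsUnit (diagonal t * Z * diagonal t + δ • 1)) (a b : Fin n) :
    ∃ M' : (Fin n → ℝ) →L[ℝ] ℝ,
      HasFDerivAt (fun s : Fin n → ℝ => (K *
        (diagonal s * (diagonal s * Z * diagonal s + δ • 1)⁻¹ * diagonal s) * K) a b) M' t ∧
      ∀ v, M' v = (K *
        ((1 - diagonal t * (diagonal t * Z * diagonal t + δ • 1)⁻¹ * diagonal t * Z) *
          diagonal v * ((diagonal t * Z * diagonal t + δ • 1)⁻¹ * diagonal t) +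
        diagonal t * (diagonal t * Z * diagonal t + δ • 1)⁻¹ * diagonal v *
          (1 - Z * (diagonal t * (diagonal t * Z * diagonal t + δ • 1)⁻¹ * diagonal t))) *
        K) a b := by
  obtain ⟨u, hu⟩ := h
  simp only [nonsing_inv_eq_ringInverse]
  rw [← hu, Ring.inverse_unit]
  exact exists_hasFDerivAt_mul_inverse_mul
    (LinearMap.toContinuousLinearMap (diagonalLinearMap (Fin n) ℝ ℝ))
    (LinearMap.toContinuousLinearMap
      (entryLinearMap ℝ ℝ a b ∘ₗ LinearMap.mulRight ℝ K ∘ₗ LinearMap.mulLeft ℝ K))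
    Z (δ • 1) t u hu

end FrechetDerivative

theorem posDef_diagonal_mul_sub_smul_one_mul_diagonal_add {n : ℕ} {K : Matrix (Fin n) (Fin n) ℝ}
    (hK : K.PosSemidef) {δ : ℝ} (hδ : 0 < δ) {t : Fin n → ℝ}
    (ht : ∀ j, t j ∈ Set.Ioo (0 : ℝ) 1) :
    (diagonal t * (K - δ • 1) * diagonal t + δ • 1).PosDef := by
  have h₁ : (diagonal t * K * diagonal t).PosSemidef := by
    simpa using hK.mul_mul_conjTranspose_same (diagonal t)
  have h₂ : (diagonal fun j => δ * (1 - t j ^ 2)).PosDef := by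
    refine PosDef.diagonal fun j => mul_pos hδ ?_
    have := ht j
    nlinarith [this.1, this.2]
  convert PosDef.posSemidef_add h₁ h₂ using 1
  rw [mul_sub, sub_mul]
  ext i j
  by_cases hij : i = j
  · subst hij
    simp
    ring
  · simp [hij]

/-- The Frobenius pairing of symmetric `D` with `K (P E Q + (P E Q)ᵀ) K`, `E = diagonal (e_j)`. -/
theorem sum_mul_sandwich_eq_diag {n : ℕ} {K D : Matrix (Fin n) (Fin n) ℝ} (hK : Kᵀ = K)
    (hD : Dᵀ = D) (P Q : Matrix (Fin n) (Fin n) ℝ) (j : Fin n) :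
    ∑ a, ∑ b, D a b * (K * (P * diagonal (Pi.single j (1 : ℝ)) * Q +
        Qᵀ * diagonal (Pi.single j (1 : ℝ)) * Pᵀ) * K : Matrix (Fin n) (Fin n) ℝ) a b =
      2 * (Q * K * D * K * P) j j := by
  set E : Matrix (Fin n) (Fin n) ℝ := diagonal (Pi.single j 1) with hE
  have hsum (X : Matrix (Fin n) (Fin n) ℝ) : ∑ a, ∑ b, D a b * X a b = trace (Dᵀ * X) := by
    simp only [trace, diag, mul_apply, transpose_apply]
    exact Finset.sum_comm
  have h₁ : trace (D * (K * (P * E * Q) * K)) = (Q * K * D * K * P) j j := by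
    have : trace (D * (K * (P * E * Q) * K)) = trace ((Q * K * D * K * P) * E) := by
      rw [show D * (K * (P * E * Q) * K) = (D * K * P * E) * (Q * K) by noncomm_ring,
        trace_mul_comm]
      congr 1
      noncomm_ring
    rw [this, hE]
    simp [trace, mul_diagonal, Pi.single_apply]
  have h₂ : trace (D * (K * (Qᵀ * E * Pᵀ) * K)) = trace (D * (K * (P * E * Q) * K)) := by
    rw [← trace_transpose, trace_mul_comm D]
    simp [transpose_mul, hK, hD, hE, Matrix.mul_assoc]
  rw [hsum, hD, mul_add, add_mul, mul_add, trace_add, h₂, h₁]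
  ring

/-- With `K` symmetric PSD, `Z = K − δI`, `L_t = T Z T + δI`,
`K̃(t) = K T L_t⁻¹ T K`, `D = K̃(t) − K`, and
`g_λ(t) = ‖K − K̃(t)‖_F² + λ Σⱼ tⱼ`, the function `g_λ` is differentiable at
every `t ∈ (0,1)ⁿ` with partial derivatives
`∂g_λ/∂t_j(t) = 4 [L_t⁻¹ T K D K (I − T L_t⁻¹ T Z)]_{jj} + λ`. -/
theorem stmt_6 {n : ℕ} (K : Matrix (Fin n) (Fin n) ℝ) (hK : K.PosSemidef)
    (δ : ℝ) (hδ : 0 < δ) (lam : ℝ)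
    (Z : Matrix (Fin n) (Fin n) ℝ) (hZ : Z = K - δ • 1)
    (L : (Fin n → ℝ) → Matrix (Fin n) (Fin n) ℝ)
    (hL : ∀ t, L t = Matrix.diagonal t * Z * Matrix.diagonal t + δ • 1)
    (Kt : (Fin n → ℝ) → Matrix (Fin n) (Fin n) ℝ)
    (hKt : ∀ t, Kt t = K * Matrix.diagonal t * (L t)⁻¹ * Matrix.diagonal t * K)
    (g : (Fin n → ℝ) → ℝ)
    (hg : ∀ t, g t = (∑ i, ∑ j, ((K - Kt t) i j) ^ 2) + lam * ∑ j, t j)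
    (t : Fin n → ℝ) (ht : ∀ j, t j ∈ Set.Ioo (0 : ℝ) 1) :
    DifferentiableAt ℝ g t ∧
      ∀ j, fderiv ℝ g t (Pi.single j 1) =
        4 * Matrix.diag ((L t)⁻¹ * Matrix.diagonal t * K * (Kt t - K) * K *
              (1 - Matrix.diagonal t * (L t)⁻¹ * Matrix.diagonal t * Z)) j
          + lam := by
  have hKs : Kᵀ = K := by simpa using hK.isHermitian.eq
  have hZs : Zᵀ = Z := by simp [hZ, hKs]
  have hLs : (L t)ᵀ = L t := by simp [hL, hZs, Matrix.mul_assoc]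
  have hLis : ((L t)⁻¹)ᵀ = (L t)⁻¹ := by rw [transpose_nonsing_inv, hLs]
  have hDs : (Kt t - K)ᵀ = Kt t - K := by simp [hKt, hKs, hLis, Matrix.mul_assoc]
  have hunit : IsUnit (diagonal t * Z * diagonal t + δ • 1) := by
    rw [hZ]
    exact (posDef_diagonal_mul_sub_smul_one_mul_diagonal_add hK hδ ht).isUnit
  choose φ hM hφ using exists_hasFDerivAt_diagonal_mul_inv_mul_diagonal K Z δ t hunit
  simp only [← hL] at hM hφ
  have hentry (a b) : HasFDerivAt (fun s => (Kt s - K) a b) (φ a b) t := by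
    refine ((hM a b).sub_const (K a b)).congr_of_eventuallyEq (.of_forall fun s => ?_)
    simp [hKt, Matrix.mul_assoc]
  have hgd : HasFDerivAt g (∑ a, ∑ b, (2 * (Kt t - K) a b) • φ a b +
      lam • ∑ j, ContinuousLinearMap.proj (R := ℝ) (φ := fun _ : Fin n => ℝ) j) t := by
    have hsq := HasFDerivAt.fun_sum fun a (_ : a ∈ Finset.univ) =>
      HasFDerivAt.fun_sum fun b (_ : b ∈ Finset.univ) => (hentry a b).pow 2
    have hlin := (HasFDerivAt.fun_sum fun j (_ : j ∈ Finset.univ) =>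
      hasFDerivAt_apply (𝕜 := ℝ) (F' := fun _ : Fin n => ℝ) j t).const_mul lam
    refine ((hsq.add hlin).congr_fderiv ?_).congr_of_eventuallyEq (.of_forall fun s => ?_)
    · simp
    · simp only [hg, Pi.add_apply]
      congr 1
      refine Finset.sum_congr rfl fun a _ => Finset.sum_congr rfl fun b _ => ?_
      simp only [Matrix.sub_apply]
      ring
  refine ⟨hgd.differentiableAt, fun j => ?_⟩
  have key := sum_mul_sandwich_eq_diag hKs hDs
    (1 - diagonal t * (L t)⁻¹ * diagonal t * Z) ((L t)⁻¹ * diagonal t) j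
  rw [hgd.fderiv]
  have hP : (1 - diagonal t * (L t)⁻¹ * diagonal t * Z)ᵀ =
      1 - Z * (diagonal t * (L t)⁻¹ * diagonal t) := by
    simp [hZs, hLis, Matrix.mul_assoc]
  have hQ : ((L t)⁻¹ * diagonal t)ᵀ = diagonal t * (L t)⁻¹ := by simp [hLis]
  rw [hP, hQ] at key
  simp only [← hφ] at key
  simp only [_root_.add_apply, _root_.sum_apply,
    _root_.smul_apply, ContinuousLinearMap.proj_apply,
    smul_eq_mul, mul_assoc (2 : ℝ), ← Finset.mul_sum, key, diag_apply]
  simp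
  ring
end

section
/- Let X be an m×n real matrix with columns x₁,…,xₙ, δ > 0, and s ∈ {0,1}ⁿ. Let Q be the matrix of the orthogonal projection of ℝᵐ onto span{x_j : s_j = 1} (i.e. the unique m×m matrix with Qᵀ = Q, Q² = Q, Q x_j = x_j for every j with s_j = 1, and Q v ∈ span{x_j : s_j = 1} for every v ∈ ℝᵐ). Then for every sequence t⁽¹⁾, t⁽²⁾, … ∈ [0,1)ⁿ converging to s, the matrices P̃(t⁽ˡ⁾) = X T⁽ˡ⁾ (T⁽ˡ⁾ Xᵀ X T⁽ˡ⁾ + δ(I − (T⁽ˡ⁾)²))⁻¹ T⁽ˡ⁾ Xᵀ converge entrywise to Q as l → ∞, where T⁽ˡ⁾ = Diag(t⁽ˡ⁾). -/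
open Matrix

section RegularizedGram

variable {ι κ : Type*} [Fintype ι] [Fintype κ] [DecidableEq κ]

/-- A Gram matrix plus a positive diagonal matrix is invertible. -/
theorem isUnit_det_gram_add_diagonal (A : Matrix ι κ ℝ) {d : κ → ℝ} (hd : ∀ j, 0 < d j) :
    IsUnit (Aᵀ * A + diagonal d).det := by
  have h : (Aᵀ * A + diagonal d).PosDef := by
    refine PosDef.posSemidef_add ?_ (PosDef.diagonal hd)
    simpa using posSemidef_conjTranspose_mul_self A
  exact (isUnit_iff_isUnit_det _).1 h.isUnit

theorem mul_gram_add_diagonal_inv_mul_gram (A : Matrix ι κ ℝ) {d : κ → ℝ} (hd : ∀ j, 0 < d j) :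
    A * (Aᵀ * A + diagonal d)⁻¹ * (Aᵀ * A) =
      A - A * (Aᵀ * A + diagonal d)⁻¹ * diagonal d := by
  rw [eq_sub_iff_add_eq, ← Matrix.mul_add,
    nonsing_inv_mul_cancel_right _ _ (isUnit_det_gram_add_diagonal A hd)]

theorem sq_mul_gram_add_diagonal_inv_apply_mul_le_one (A : Matrix ι κ ℝ) {d : κ → ℝ}
    (hd : ∀ j, 0 < d j) (i : ι) (j : κ) :
    (A * (Aᵀ * A + diagonal d)⁻¹) i j ^ 2 * d j ≤ 1 := by
  set W := (Aᵀ * A + diagonal d)⁻¹ with hW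
  have hWt : Wᵀ = W := by
    rw [hW, transpose_nonsing_inv]
    simp
  have hid : (A * W)ᵀ * (A * W) + Wᵀ * diagonal d * W = W := by
    calc _ = Wᵀ * ((Aᵀ * A + diagonal d) * W) := by
          simp only [transpose_mul, Matrix.mul_add, Matrix.add_mul, Matrix.mul_assoc]
      _ = W := by
          rw [hW, mul_nonsing_inv _ (isUnit_det_gram_add_diagonal A hd), Matrix.mul_one, ← hW, hWt]
  have hjj := congrFun (congrFun hid j) j
  rw [Matrix.add_apply, Matrix.mul_apply, Matrix.mul_apply] at hjj
  simp only [mul_diagonal, transpose_apply] at hjj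
  have h₁ : (A * W) i j * (A * W) i j ≤ ∑ k, (A * W) k j * (A * W) k j :=
    Finset.single_le_sum (f := fun k => (A * W) k j * (A * W) k j)
      (fun k _ => mul_self_nonneg _) (Finset.mem_univ i)
  have h₂ : W j j * d j * W j j ≤ ∑ k, W k j * d k * W k j :=
    Finset.single_le_sum (f := fun k => W k j * d k * W k j)
      (fun k _ => by nlinarith [mul_nonneg (hd k).le (mul_self_nonneg (W k j))])
      (Finset.mem_univ j)
  have h₃ : (A * W) i j ^ 2 ≤ W j j - d j * W j j ^ 2 := by nlinarith
  nlinarith [mul_le_mul_of_nonneg_right h₃ (hd j).le, sq_nonneg (d j * W j j - 1)]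

end RegularizedGram

/-- If `b l ^ 2 * d l` is bounded by one and `c l ^ 2 / d l` tends to zero, so does `b l * c l`. -/
theorem tendsto_mul_zero_of_sq_mul_le_one {α : Type*} {l : Filter α} {b c d : α → ℝ}
    (hd : ∀ x, 0 < d x) (hb : ∀ x, b x ^ 2 * d x ≤ 1)
    (hc : Filter.Tendsto (fun x => c x ^ 2 / d x) l (nhds 0)) :
    Filter.Tendsto (fun x => b x * c x) l (nhds 0) := by
  have hsq : Filter.Tendsto (fun x => (b x * c x) ^ 2) l (nhds 0) := by
    refine squeeze_zero (fun x => sq_nonneg _) (fun x => ?_) hc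
    rw [le_div_iff₀ (hd x)]
    nlinarith [mul_le_mul_of_nonneg_right (hb x) (sq_nonneg (c x))]
  have h := hsq.sqrt
  simp only [Real.sqrt_sq_eq_abs, Real.sqrt_zero] at h
  exact (tendsto_zero_iff_abs_tendsto_zero _).2 h

/-- Let `Q` be the orthogonal projection of `ℝᵐ` onto
`span{x_j : s_j = 1}` for a binary vector `s ∈ {0,1}ⁿ`.  Then for every
sequence `t⁽ˡ⁾ ∈ [0,1)ⁿ` converging to `s`, the matrices
`P̃(t⁽ˡ⁾) = X T⁽ˡ⁾ (T⁽ˡ⁾ Xᵀ X T⁽ˡ⁾ + δ(I − (T⁽ˡ⁾)²))⁻¹ T⁽ˡ⁾ Xᵀ` converge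
(entrywise) to `Q`. -/
theorem stmt_14 {m n : ℕ} (X : Matrix (Fin m) (Fin n) ℝ)
    (δ : ℝ) (hδ : 0 < δ)
    (s : Fin n → ℝ) (hs : ∀ j, s j = 0 ∨ s j = 1)
    (Q : Matrix (Fin m) (Fin m) ℝ)
    (hQsymm : Qᵀ = Q) (hQidem : Q * Q = Q)
    (hQfix : ∀ j, s j = 1 → Q *ᵥ (fun i => X i j) = fun i => X i j)
    (hQrange : ∀ v : Fin m → ℝ,
      Q *ᵥ v ∈ Submodule.span ℝ {x : Fin m → ℝ | ∃ j, s j = 1 ∧ x = fun i => X i j})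
    (tseq : ℕ → (Fin n → ℝ))
    (htseq : ∀ l j, tseq l j ∈ Set.Ico (0 : ℝ) 1)
    (hconv : Filter.Tendsto tseq Filter.atTop (nhds s)) :
    Filter.Tendsto
      (fun l => X * Matrix.diagonal (tseq l) *
          (Matrix.diagonal (tseq l) * (Xᵀ * X) * Matrix.diagonal (tseq l)
            + δ • (1 - Matrix.diagonal (tseq l) ^ 2))⁻¹ *
          Matrix.diagonal (tseq l) * Xᵀ)
      Filter.atTop (nhds Q) := by
  set d : ℕ → Fin n → ℝ := fun l j => δ * (1 - tseq l j ^ 2) with hd_def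
  set A : ℕ → Matrix (Fin m) (Fin n) ℝ := fun l => X * diagonal (tseq l) with hA
  set B : ℕ → Matrix (Fin m) (Fin n) ℝ :=
    fun l => A l * ((A l)ᵀ * A l + diagonal (d l))⁻¹ with hB
  have hd : ∀ l j, 0 < d l j := fun l j => by
    have := htseq l j
    exact mul_pos hδ (by nlinarith [this.1, this.2])
  have hform : ∀ l, X * diagonal (tseq l) * (diagonal (tseq l) * (Xᵀ * X) * diagonal (tseq l)
      + δ • (1 - diagonal (tseq l) ^ 2))⁻¹ * diagonal (tseq l) * Xᵀ = B l * (A l)ᵀ := fun l => by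
    have hD : δ • (1 - diagonal (tseq l) ^ 2) = diagonal (d l) := by
      rw [diagonal_pow, ← diagonal_one, diagonal_sub, ← diagonal_smul]
      rfl
    simp only [hB, hA, hD, transpose_mul, diagonal_transpose, Matrix.mul_assoc]
  simp only [hform]
  have ht : ∀ j, Filter.Tendsto (fun l => tseq l j) Filter.atTop (nhds (s j)) :=
    tendsto_pi_nhds.1 hconv
  have hdlim : ∀ j, Filter.Tendsto (fun l => d l j) Filter.atTop (nhds (δ * (1 - s j ^ 2))) :=
    fun j => (((ht j).pow 2).const_sub 1).const_mul δ
  have hbound : ∀ i j l, B l i j ^ 2 * d l j ≤ 1 := fun i j l =>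
    sq_mul_gram_add_diagonal_inv_apply_mul_le_one (A l) (hd l) i j
  have hoff : ∀ i j, s j = 0 →
      Filter.Tendsto (fun l => B l i j * tseq l j) Filter.atTop (nhds 0) := fun i j hj => by
    refine tendsto_mul_zero_of_sq_mul_le_one (fun l => hd l j) (hbound i j) ?_
    have h := ((ht j).pow 2).div (hdlim j) (by simp [hj, hδ.ne'])
    rw [hj, zero_pow two_ne_zero, zero_div] at h
    exact h
  have hon : ∀ i j, s j = 1 →
      Filter.Tendsto (fun l => B l i j * d l j) Filter.atTop (nhds 0) := fun i j hj => by
    refine tendsto_mul_zero_of_sq_mul_le_one (fun l => hd l j) (hbound i j) ?_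
    have h := hdlim j
    simp only [hj, one_pow, sub_self, mul_zero] at h
    refine h.congr fun l => ?_
    rw [sq, mul_div_cancel_right₀ _ (hd l j).ne']
  have hcol : ∀ j, s j = 1 → Filter.Tendsto (fun l => (B l * (A l)ᵀ) *ᵥ fun i => X i j)
      Filter.atTop (nhds fun i => X i j) := fun j hj => by
    refine tendsto_pi_nhds.2 fun i => ?_
    have htj := ht j
    rw [hj] at htj
    have hlim := ((htj.const_mul (X i j)).sub (hon i j hj)).div htj one_ne_zero
    simp only [mul_one, sub_zero, div_one] at hlim
    refine hlim.congr' ?_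
    filter_upwards [htj.eventually_ne one_ne_zero] with l hl
    have h := congrFun (congrFun (mul_gram_add_diagonal_inv_mul_gram (A l) (hd l)) i) j
    change (B l * ((A l)ᵀ * A l)) i j = (A l - B l * diagonal (d l)) i j at h
    rw [← Matrix.mul_assoc, Matrix.sub_apply, mul_diagonal] at h
    have h' : (B l * (A l)ᵀ * A l) i j = (B l * (A l)ᵀ * X) i j * tseq l j := by
      rw [show A l = X * diagonal (tseq l) from rfl, ← Matrix.mul_assoc _ X, mul_diagonal]
    have h'' : A l i j = X i j * tseq l j := mul_diagonal _ _ _ _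
    rw [h', h''] at h
    exact (eq_div_of_mul_eq hl h).symm
  have hspan : ∀ v ∈ Submodule.span ℝ {x : Fin m → ℝ | ∃ j, s j = 1 ∧ x = fun i => X i j},
      Filter.Tendsto (fun l => (B l * (A l)ᵀ) *ᵥ v) Filter.atTop (nhds v) := fun v hv => by
    induction hv using Submodule.span_induction with
    | mem x hx =>
      obtain ⟨j, hj, rfl⟩ := hx
      exact hcol j hj
    | zero => simp
    | add x y _ _ hx hy => simpa only [mulVec_add] using hx.add hy
    | smul a x _ hx => simpa only [mulVec_smul] using hx.const_smul a
  have horth : ∀ v, Filter.Tendsto (fun l => (B l * (A l)ᵀ) *ᵥ (v - Q *ᵥ v))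
      Filter.atTop (nhds 0) := fun v => by
    refine tendsto_pi_nhds.2 fun i => ?_
    have hexp : ∀ l, ((B l * (A l)ᵀ) *ᵥ (v - Q *ᵥ v)) i =
        ∑ j, B l i j * tseq l j * (Xᵀ *ᵥ (v - Q *ᵥ v)) j := fun l => by
      rw [show (A l)ᵀ = diagonal (tseq l) * Xᵀ by simp [hA], ← Matrix.mul_assoc, ← mulVec_mulVec]
      simp only [mulVec, dotProduct, mul_diagonal]
    simp only [hexp]
    rw [Pi.zero_apply, ← Finset.sum_const_zero (ι := Fin n) (s := Finset.univ)]
    refine tendsto_finsetSum _ fun j _ => ?_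
    rcases hs j with hj | hj
    · simpa using (hoff i j hj).mul_const ((Xᵀ *ᵥ (v - Q *ᵥ v)) j)
    · have hz : (Xᵀ *ᵥ (v - Q *ᵥ v)) j = 0 := by
        change (fun i => X i j) ⬝ᵥ (v - Q *ᵥ v) = 0
        rw [dotProduct_sub, dotProduct_mulVec, ← mulVec_transpose, hQsymm, hQfix j hj, sub_self]
      simp [hz]
  have hvec : ∀ v, Filter.Tendsto (fun l => (B l * (A l)ᵀ) *ᵥ v) Filter.atTop
      (nhds (Q *ᵥ v)) := fun v => by
    simpa only [← mulVec_add, add_sub_cancel, add_zero] using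
      (hspan _ (hQrange v)).add (horth v)
  refine tendsto_pi_nhds.2 fun i => tendsto_pi_nhds.2 fun k => ?_
  simpa only [mulVec_single_one, col_apply] using
    tendsto_pi_nhds.1 (hvec (Pi.single k 1)) i
end

section
/- Let X be an m×n real matrix, δ > 0, λ ∈ ℝ, K = XᵀX, and for t ∈ [0,1)ⁿ let L_t = T K T + δ(I − T²) and f_λ(t) = −tr(K T L_t⁻¹ T K) + λ Σᵢ tᵢ. Fix an index j and fix real numbers w_i for i ≠ j, and define h : ℝ → ℝ by h(u) = f_λ(t(w)) where w_j = u and t(w)_i = 1 − exp(−w_i²) for i = 1,…,n. Then h is differentiable and its derivative satisfies h′(u) → 0 as u → 0. -/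
open Matrix

theorem Matrix.contDiff_mul_apply {l m n : Type*} [Fintype m] {k : WithTop ℕ∞}
    {A : ℝ → Matrix l m ℝ} {B : ℝ → Matrix m n ℝ}
    (hA : ∀ i j, ContDiff ℝ k fun u => A u i j) (hB : ∀ i j, ContDiff ℝ k fun u => B u i j)
    (i : l) (j : n) : ContDiff ℝ k fun u => (A u * B u) i j := by
  simp only [Matrix.mul_apply]
  exact ContDiff.sum fun x _ => (hA i x).mul (hB x j)

theorem Matrix.contDiff_diagonal_apply {n : Type*} [DecidableEq n] {k : WithTop ℕ∞}
    {t : ℝ → n → ℝ} (ht : ∀ i, ContDiff ℝ k fun u => t u i) (i j : n) :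
    ContDiff ℝ k fun u => Matrix.diagonal (t u) i j := by
  by_cases hij : i = j
  · subst hij
    simpa using ht i
  · simpa [hij] using contDiff_const

theorem Matrix.contDiff_det {n : Type*} [Fintype n] [DecidableEq n] {k : WithTop ℕ∞}
    {A : ℝ → Matrix n n ℝ} (hA : ∀ i j, ContDiff ℝ k fun u => A u i j) :
    ContDiff ℝ k fun u => (A u).det := by
  simp only [Matrix.det_apply']
  exact ContDiff.sum fun σ _ => contDiff_const.mul (contDiff_prod fun i _ => hA (σ i) i)

theorem Matrix.contDiff_inv_apply {n : Type*} [Fintype n] [DecidableEq n] {k : WithTop ℕ∞}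
    {A : ℝ → Matrix n n ℝ} (hA : ∀ i j, ContDiff ℝ k fun u => A u i j)
    (hdet : ∀ u, (A u).det ≠ 0) (i j : n) : ContDiff ℝ k fun u => (A u)⁻¹ i j := by
  simp only [Matrix.inv_def, Ring.inverse_eq_inv', Matrix.smul_apply, smul_eq_mul,
    Matrix.adjugate_apply]
  refine ((Matrix.contDiff_det hA).inv hdet).mul (Matrix.contDiff_det fun a b => ?_)
  by_cases haj : a = j
  · subst haj
    simpa using contDiff_const
  · simpa [Matrix.updateRow_ne haj] using hA a b

theorem Matrix.det_diagonal_mul_gram_add_ne_zero {m n : Type*} [Fintype m] [Fintype n]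
    [DecidableEq n] (X : Matrix m n ℝ) {δ : ℝ} (hδ : 0 < δ) {t : n → ℝ}
    (ht : ∀ i, t i ^ 2 < 1) :
    (Matrix.diagonal t * (Xᵀ * X) * Matrix.diagonal t
      + δ • (1 - Matrix.diagonal t ^ 2)).det ≠ 0 := by
  have hpsd : (Matrix.diagonal t * (Xᵀ * X) * Matrix.diagonal t).PosSemidef := by
    have := Matrix.posSemidef_conjTranspose_mul_self (X * Matrix.diagonal t)
    simpa [Matrix.conjTranspose_eq_transpose_of_trivial, Matrix.transpose_mul,
      Matrix.mul_assoc] using this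
  have hpd : (δ • (1 - Matrix.diagonal t ^ 2) : Matrix n n ℝ).PosDef := by
    have heq : (δ • (1 - Matrix.diagonal t ^ 2) : Matrix n n ℝ)
        = Matrix.diagonal fun i => δ * (1 - t i ^ 2) := by
      rw [Matrix.diagonal_pow, ← Matrix.diagonal_one, Matrix.diagonal_sub, ← Matrix.diagonal_smul]
      rfl
    rw [heq]
    exact Matrix.PosDef.diagonal fun i => mul_pos hδ (sub_pos.2 (ht i))
  exact (Matrix.PosDef.posSemidef_add hpsd hpd).det_pos.ne'

theorem Function.Even.deriv_zero {g : ℝ → ℝ} (hg : Function.Even g) : deriv g 0 = 0 := by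
  have h := deriv_comp_neg g 0
  rw [funext hg, neg_zero] at h
  linarith

/-- With `K = XᵀX`, `L_t = T K T + δ(I − T²)` and
`f_λ(t) = −tr(K T L_t⁻¹ T K) + λ Σᵢ tᵢ`, fix an index `j` and values `w_i`
for `i ≠ j`, and let `h(u) = f_λ(t(w))` where `w_j = u` and
`t(w)_i = 1 − exp(−w_i²)`.  Then `h` is differentiable and `h′(u) → 0`
as `u → 0`. -/
theorem stmt_16 {m n : ℕ} (X : Matrix (Fin m) (Fin n) ℝ)
    (δ : ℝ) (hδ : 0 < δ) (lam : ℝ)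
    (K : Matrix (Fin n) (Fin n) ℝ) (hK : K = Xᵀ * X)
    (L : (Fin n → ℝ) → Matrix (Fin n) (Fin n) ℝ)
    (hL : ∀ t, L t = Matrix.diagonal t * K * Matrix.diagonal t
        + δ • (1 - Matrix.diagonal t ^ 2))
    (f : (Fin n → ℝ) → ℝ)
    (hf : ∀ t, f t =
      -(K * Matrix.diagonal t * (L t)⁻¹ * Matrix.diagonal t * K).trace
        + lam * ∑ i, t i)
    (j : Fin n) (w : Fin n → ℝ)
    (h : ℝ → ℝ)
    (hh : ∀ u, h u = f (fun i => 1 - Real.exp (-(Function.update w j u i) ^ 2))) :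
    Differentiable ℝ h ∧
      Filter.Tendsto (fun u => deriv h u) (nhds 0) (nhds 0) := by
  set t : ℝ → Fin n → ℝ := fun u i => 1 - Real.exp (-(Function.update w j u i) ^ 2) with ht
  have ht_contDiff : ∀ i, ContDiff ℝ 1 fun u => t u i := by
    intro i
    have hupd : ContDiff ℝ 1 fun u => Function.update w j u i := by
      by_cases hij : i = j
      · subst hij
        simpa using contDiff_fun_id
      · simpa [hij] using contDiff_const
    exact contDiff_const.sub (hupd.pow 2).neg.exp
  have ht_sq : ∀ u i, t u i ^ 2 < 1 := by
    intro u i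
    have hpos := Real.exp_pos (-(Function.update w j u i) ^ 2)
    have hle : Real.exp (-(Function.update w j u i) ^ 2) ≤ 1 :=
      Real.exp_le_one_iff.2 (neg_nonpos.2 (sq_nonneg _))
    simp only [ht]
    nlinarith
  have hT := Matrix.contDiff_diagonal_apply ht_contDiff
  have hconst : ∀ (A : Matrix (Fin n) (Fin n) ℝ) (a b : Fin n),
      ContDiff ℝ 1 fun _ : ℝ => A a b := fun _ _ _ => contDiff_const
  have hL_contDiff : ∀ a b, ContDiff ℝ 1 fun u => L (t u) a b := by
    intro a b
    simp only [hL, Matrix.add_apply, Matrix.smul_apply, Matrix.sub_apply, smul_eq_mul, pow_two]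
    exact (Matrix.contDiff_mul_apply (Matrix.contDiff_mul_apply hT (hconst K)) hT a b).add
      (contDiff_const.mul (contDiff_const.sub (Matrix.contDiff_mul_apply hT hT a b)))
  have hL_det : ∀ u, (L (t u)).det ≠ 0 := by
    intro u
    rw [hL, hK]
    exact Matrix.det_diagonal_mul_gram_add_ne_zero X hδ (ht_sq u)
  have hprod := Matrix.contDiff_mul_apply (Matrix.contDiff_mul_apply (Matrix.contDiff_mul_apply
    (Matrix.contDiff_mul_apply (hconst K) hT) (Matrix.contDiff_inv_apply hL_contDiff hL_det)) hT)
    (hconst K)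
  have hh_contDiff : ContDiff ℝ 1 h := by
    rw [funext hh]
    simp only [hf, Matrix.trace, Matrix.diag_apply]
    exact (ContDiff.sum fun i _ => hprod i i).neg.add
      (contDiff_const.mul (ContDiff.sum fun i _ => ht_contDiff i))
  have hh_even : Function.Even h := by
    intro u
    rw [hh, hh]
    congr 1
    funext i
    by_cases hij : i = j
    · subst hij
      simp
    · simp [hij]
  refine ⟨hh_contDiff.differentiable one_ne_zero, ?_⟩
  simpa [hh_even.deriv_zero] using (hh_contDiff.continuous_deriv le_rfl).tendsto 0
end
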